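/- Suppose the cost has the form c(x,m) = G(∫ F(x,y) m(dy)). Let μ ∈ P(X), ν ∈ P(Y) with I_c(μ,ν) < +∞, let q̄ ∈ Q(μ,ν) be a kernel minimizer (∫ c(x,q̄^x) μ(dx) = I_c(μ,ν)), and let f̄ : Y → ℝ be ν-integrable with I_c(μ,ν) = ∫ K_c f̄ dμ − ∫ f̄ dν. Then for μ-almost every x ∈ X: G'(∫ F(x,z) q̄^x(dz))·F(x,y) + f̄(y) ≥ 0 for all y ∈ Y, and equality holds for q̄^x-almost every y ∈ Y. In particular, if G'(0) = −∞, then q̄^x(Y) > 0 for μ-almost every x. -/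

import Mathlib

open MeasureTheory ProbabilityTheory Topology Filter Set Metric
open scoped NNReal ENNReal

noncomputable section

namespace UWOT

/-- The nonnegative part of an extended real, as an extended nonnegative real. -/
def epos (x : EReal) : ℝ≥0∞ := if x = ⊤ then ⊤ else ENNReal.ofReal x.toReal

/-- Integral of an `EReal`-valued function: positive part minus negative part. -/
def eintegral {α : Type*} [MeasurableSpace α] (μ : Measure α) (g : α → EReal) : EReal :=
  ((∫⁻ x, epos (g x) ∂μ : ℝ≥0∞) : EReal) - ((∫⁻ x, epos (-(g x)) ∂μ : ℝ≥0∞) : EReal)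

/-- Integral of a real-valued function, with value `+∞` when the positive part is not
integrable.  This is the integral "understood in `ℝ ∪ {+∞}`". -/
def eintegralR {α : Type*} [MeasurableSpace α] (μ : Measure α) (f : α → ℝ) : EReal :=
  eintegral μ fun x => (f x : EReal)

variable {X Y : Type*}
  [TopologicalSpace X] [PolishSpace X] [MeasurableSpace X] [BorelSpace X]
  [TopologicalSpace Y] [PolishSpace Y] [MeasurableSpace Y] [BorelSpace Y]

/-- A nonnegative kernel from `X` to `Y` : a measurable family of finite nonnegative
measures on `Y`. -/
def IsKernel (q : X → FiniteMeasure Y) : Prop :=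
  Measurable fun x => (q x : Measure Y)

/-- `μ q = ν` : the kernel `q` transports `μ` onto `ν`. -/
def Transports (μ : Measure X) (q : X → FiniteMeasure Y) (ν : Measure Y) : Prop :=
  μ.bind (fun x => (q x : Measure Y)) = ν

/-- The transport cost `I_c(μ,ν)`, an infimum in `ℝ ∪ {+∞}` (it equals `⊤` when no
admissible kernel exists). -/
def transportCost (c : X → FiniteMeasure Y → ℝ) (μ : Measure X) (ν : Measure Y) : EReal :=
  sInf {r : EReal | ∃ q : X → FiniteMeasure Y,
    IsKernel q ∧ Transports μ q ν ∧ r = eintegralR μ fun x => c x (q x)}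

/-- Standing assumptions on the cost function: convexity in the second variable, joint
lower semicontinuity, and the lower bound (LB). -/
structure IsCost (c : X → FiniteMeasure Y → ℝ) : Prop where
  convex : ∀ (x : X) (m₀ m₁ : FiniteMeasure Y) (t : ℝ≥0), t ≤ 1 →
    c x ((1 - t) • m₀ + t • m₁) ≤ (1 - (t : ℝ)) * c x m₀ + (t : ℝ) * c x m₁
  lsc : LowerSemicontinuous fun p : X × FiniteMeasure Y => c p.1 p.2
  lb : ∃ r₀ r₁ : ℝ, ∀ (x : X) (m : FiniteMeasure Y), r₀ + r₁ * (m.mass : ℝ) ≤ c x m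

/-- The topological support of a measure. -/
def msupport {Z : Type*} [TopologicalSpace Z] [MeasurableSpace Z] (μ : Measure Z) : Set Z :=
  {x | ∀ U : Set Z, IsOpen U → x ∈ U → 0 < μ U}

/-- Membership in `Π(≪ μ, ν)`. -/
def MemPiAC (μ : Measure X) (ν : Measure Y) (π : ProbabilityMeasure (X × Y)) : Prop :=
  (π : Measure (X × Y)).fst ≪ μ ∧ (π : Measure (X × Y)).snd = ν

/-- Membership in `Π(Supp(μ), ν)`. -/
def MemPiSupp (μ : Measure X) (ν : Measure Y) (π : ProbabilityMeasure (X × Y)) : Prop :=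
  (π : Measure (X × Y)).fst (msupport μ) = 1 ∧ (π : Measure (X × Y)).snd = ν

variable [Nonempty Y]

/-- The disintegration kernel `π^x` of `π` with respect to its first marginal, as a
finite (probability) measure. -/
def condFM (π : ProbabilityMeasure (X × Y)) (x : X) : FiniteMeasure Y :=
  ⟨(π : Measure (X × Y)).condKernel x, inferInstance⟩

/-- The measure `(dπ₁/dμ)(x) • π^x`. -/
def fiber (μ : Measure X) (π : ProbabilityMeasure (X × Y)) (x : X) : FiniteMeasure Y :=
  ((π : Measure (X × Y)).fst.rnDeriv μ x).toNNReal • condFM π x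

/-- The functional `I_c^μ[π] = ∫ c(x, (dπ₁/dμ)(x) π^x) dμ`, in `ℝ ∪ {+∞}`. -/
def Icmu (c : X → FiniteMeasure Y → ℝ) (μ : Measure X) (π : ProbabilityMeasure (X × Y)) :
    EReal :=
  eintegralR μ fun x => c x (fiber μ π x)

/-- A strong solution of the transport problem. -/
def IsStrongSol (c : X → FiniteMeasure Y → ℝ) (μ : Measure X) (ν : Measure Y)
    (π : ProbabilityMeasure (X × Y)) : Prop :=
  MemPiAC μ ν π ∧ Icmu c μ π = transportCost c μ ν

/-- A weak solution of the transport problem. -/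
def IsWeakSol (c : X → FiniteMeasure Y → ℝ) (μ : Measure X) (ν : Measure Y)
    (π : ProbabilityMeasure (X × Y)) : Prop :=
  ∃ s : ℕ → ProbabilityMeasure (X × Y), (∀ n, MemPiAC μ ν (s n)) ∧
    Tendsto s atTop (𝓝 π) ∧
    Tendsto (fun n => Icmu c μ (s n)) atTop (𝓝 (transportCost c μ ν))

/-- The recession function `c'_∞(x,m) = lim_{λ→∞} c(x, λm)/λ`. -/
def recession (c : X → FiniteMeasure Y → ℝ) (x : X) (m : FiniteMeasure Y) : EReal :=
  limsup (fun lam : ℝ≥0 => ((c x (lam • m) / (lam : ℝ) : ℝ) : EReal)) atTop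

/-- The extended functional `bar I_c^μ[π]`. -/
def barI (c : X → FiniteMeasure Y → ℝ) (μ : Measure X) (π : ProbabilityMeasure (X × Y)) :
    EReal :=
  eintegralR μ (fun x => c x (fiber μ π x)) +
    eintegral ((π : Measure (X × Y)).fst.singularPart μ) (fun x => recession c x (condFM π x))

/-- Assumption (A). -/
def AssumpA (c : X → FiniteMeasure Y → ℝ) : Prop :=
  ∃ (a : ℕ → C(X, ℝ)) (b : ℕ → C(X × Y, ℝ)),
    ∀ (x : X) (m : FiniteMeasure Y),
      IsLUB (range fun k => (∫ y, b k (x, y) ∂(m : Measure Y)) + a k x) (c x m)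

/-- Assumption (B). -/
def AssumpB (c : X → FiniteMeasure Y → ℝ) : Prop :=
  ∀ (x : X) (m : FiniteMeasure Y), m ≠ 0 →
    Tendsto (fun lam : ℝ≥0 => c x (lam • m) / (lam : ℝ)) atTop atTop

/-- Assumption (C). -/
def AssumpC (c : X → FiniteMeasure Y → ℝ) : Prop :=
  (∀ m : FiniteMeasure Y, Continuous fun x : X => c x m) ∧
  (∀ m : FiniteMeasure Y, Continuous fun x : X => recession c x m) ∧
  (∃ a : ℝ, 0 ≤ a ∧
    ∀ (x : X) (p : FiniteMeasure Y), p.mass = 1 → recession c x p ≤ (a : EReal))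

/-- Assumption (Approx). -/
def AssumpApprox (c : X → FiniteMeasure Y → ℝ) : Prop :=
  ∀ (μ : Measure X) (ν : Measure Y), IsProbabilityMeasure μ → IsProbabilityMeasure ν →
    ∀ π : ProbabilityMeasure (X × Y), MemPiSupp μ ν π →
      ∃ s : ℕ → ProbabilityMeasure (X × Y), (∀ n, MemPiAC μ ν (s n)) ∧
        Tendsto (fun n => Icmu c μ (s n)) atTop (𝓝 (barI c μ π))

/-- The operator `K_c` acting on continuous functions. -/
def Kc (c : X → FiniteMeasure Y → ℝ) (f : Y → ℝ) (x : X) : EReal :=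
  ⨅ m : FiniteMeasure Y, (((∫ y, f y ∂(m : Measure Y)) + c x m : ℝ) : EReal)


/-- The cost `c(x,m) = G(∫ F(x,y) m(dy))`. -/
def cGF (F : X → Y → ℝ) (G : ℝ → ℝ) (x : X) (m : FiniteMeasure Y) : ℝ :=
  G (∫ y, F x y ∂(m : Measure Y))

/-- The operator `K_c` acting on (merely integrable) functions. -/
def KcL1 (c : X → FiniteMeasure Y → ℝ) (f : Y → ℝ) (x : X) : EReal :=
  ⨅ m : {m : FiniteMeasure Y // Integrable f (m : Measure Y)},
    (((∫ y, f y ∂((m : FiniteMeasure Y) : Measure Y)) + c x (m : FiniteMeasure Y) : ℝ) :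
      EReal)

lemma measurable_epos : Measurable epos :=
  Measurable.ite (measurableSet_singleton _) measurable_const
    (ENNReal.measurable_ofReal.comp measurable_ereal_toReal)

lemma epos_of_ne_top {x : EReal} (h : x ≠ ⊤) : epos x = ENNReal.ofReal x.toReal := if_neg h

lemma epos_coe (r : ℝ) : epos (r : EReal) = ENNReal.ofReal r := by
  rw [epos_of_ne_top (EReal.coe_ne_top r), EReal.toReal_coe]

/-- A function with finite extended integral is almost everywhere finite and integrable. -/
lemma integrable_toReal_of_eintegral {α : Type*} [MeasurableSpace α] {μ : Measure α}
    {g : α → EReal} (hg : Measurable g) (htop : eintegral μ g ≠ ⊤) (hbot : eintegral μ g ≠ ⊥) :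
    (∀ᵐ x ∂μ, g x ≠ ⊤ ∧ g x ≠ ⊥) ∧ Integrable (fun x => (g x).toReal) μ ∧
      eintegral μ g = ((∫ x, (g x).toReal ∂μ : ℝ) : EReal) := by
  have hpm : Measurable fun x => epos (g x) := measurable_epos.comp hg
  have hnm : Measurable fun x => epos (-(g x)) := measurable_epos.comp hg.neg
  have hN : ∫⁻ x, epos (-(g x)) ∂μ ≠ ⊤ := by
    intro h
    apply hbot
    rw [eintegral, h]
    simp
  have hP : ∫⁻ x, epos (g x) ∂μ ≠ ⊤ := by
    intro h
    apply htop
    rw [eintegral, h]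
    lift ∫⁻ x, epos (-(g x)) ∂μ to ℝ≥0 using hN with n
    exact EReal.top_sub_coe (n : ℝ)
  have hfin : ∀ᵐ x ∂μ, g x ≠ ⊤ ∧ g x ≠ ⊥ := by
    filter_upwards [ae_lt_top hpm hP, ae_lt_top hnm hN] with x h1 h2
    constructor
    · intro h
      simp [h, epos] at h1
    · intro h
      simp [h, epos] at h2
  have hp : ∫⁻ x, epos (g x) ∂μ = ∫⁻ x, ENNReal.ofReal (g x).toReal ∂μ := by
    refine lintegral_congr_ae ?_
    filter_upwards [hfin] with x hx using epos_of_ne_top hx.1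
  have hn : ∫⁻ x, epos (-(g x)) ∂μ = ∫⁻ x, ENNReal.ofReal (-(g x).toReal) ∂μ := by
    refine lintegral_congr_ae ?_
    filter_upwards [hfin] with x hx
    rw [epos_of_ne_top (by simpa using hx.2), EReal.toReal_neg_eq]
  have hm : Measurable fun x => (g x).toReal := hg.ereal_toReal
  have hint : Integrable (fun x => (g x).toReal) μ := by
    refine ⟨hm.aestronglyMeasurable, ?_⟩
    rw [hasFiniteIntegral_iff_norm]
    refine lt_of_le_of_lt (b := ∫⁻ x, (ENNReal.ofReal (g x).toReal +
      ENNReal.ofReal (-(g x).toReal)) ∂μ) (lintegral_mono fun x => ?_) ?_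
    · rcases le_total 0 (g x).toReal with h | h
      · simp [Real.norm_of_nonneg h]
      · simp [Real.norm_of_nonpos h]
    · rw [lintegral_add_left hm.ennreal_ofReal, ← hp, ← hn]
      exact ENNReal.add_lt_top.2 ⟨hP.lt_top, hN.lt_top⟩
  refine ⟨hfin, hint, ?_⟩
  rw [integral_eq_lintegral_pos_part_sub_lintegral_neg_part hint, ← hp, ← hn, eintegral]
  rw [EReal.coe_sub, EReal.coe_ennreal_toReal hP, EReal.coe_ennreal_toReal hN]

/-- The extended integral of a function with an integrable lower bound is not `-∞`. -/
lemma eintegralR_ne_bot {α : Type*} [MeasurableSpace α] {μ : Measure α} {f h : α → ℝ}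
    (hh : Integrable h μ) (hle : h ≤ f) : eintegralR μ f ≠ ⊥ := by
  have hN : ∫⁻ x, epos (-((f x : ℝ) : EReal)) ∂μ ≠ ⊤ := by
    refine ne_top_of_le_ne_top hh.neg.lintegral_lt_top.ne (lintegral_mono fun x => ?_)
    rw [← EReal.coe_neg, epos_coe]
    exact ENNReal.ofReal_le_ofReal (neg_le_neg (hle x))
  rw [eintegralR, eintegral]
  lift ∫⁻ x, epos (-((f x : ℝ) : EReal)) ∂μ to ℝ≥0 using hN with n
  intro h
  rw [sub_eq_add_neg, EReal.add_eq_bot_iff] at h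
  rcases h with h | h
  · exact EReal.coe_ennreal_ne_bot _ h
  · exact EReal.coe_ne_top (n : ℝ) (EReal.neg_eq_bot_iff.1 h)

/-- A kernel all of whose fibers are finite measures is s-finite. -/
lemma isSFiniteKernel_of_isFiniteMeasure {α β : Type*} [MeasurableSpace α] [MeasurableSpace β]
    (κ : Kernel α β) [∀ x, IsFiniteMeasure (κ x)] : IsSFiniteKernel κ := by
  classical
  let N : α → ℕ := fun x => ⌊(κ x univ).toReal⌋₊
  have hN : Measurable N := ((κ.measurable_coe .univ).ennreal_toReal).nat_floor
  have hs : ∀ n, MeasurableSet (N ⁻¹' {n}) := fun n => hN (measurableSet_singleton n)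
  refine ⟨fun n => Kernel.piecewise (hs n) κ 0, fun n => ⟨(n + 1 : ℕ), by simp, fun x => ?_⟩, ?_⟩
  · rw [Kernel.piecewise_apply]
    split_ifs with h
    · have h' : ⌊(κ x univ).toReal⌋₊ = n := h
      have h2 := (Nat.lt_floor_add_one (κ x univ).toReal).le
      rw [h'] at h2
      rw [← ENNReal.ofReal_toReal (measure_ne_top (κ x) univ)]
      refine (ENNReal.ofReal_le_ofReal h2).trans ?_
      exact_mod_cast (ENNReal.ofReal_natCast (n + 1)).le
    · simp
  · ext x s hms
    rw [Kernel.sum_apply' _ _ hms, tsum_eq_single (N x)]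
    · simp [Kernel.piecewise_apply]
    · intro n hn
      simp [Kernel.piecewise_apply, hn.symm]

/-- A one-sided minimum at `0` has nonnegative derivative. -/
lemma nonneg_of_hasDerivAt_of_le {φ : ℝ → ℝ} {d : ℝ} (hd : HasDerivAt φ d 0)
    (hmin : ∀ t, 0 < t → t < 1 → φ 0 ≤ φ t) : 0 ≤ d := by
  refine ge_of_tendsto hd.tendsto_slope_zero_right ?_
  filter_upwards [Ioo_mem_nhdsGT (zero_lt_one' ℝ)] with t ht
  simp only [zero_add, smul_eq_mul]
  exact mul_nonneg (inv_nonneg.2 ht.1.le) (sub_nonneg.2 (hmin t ht.1 ht.2))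

section FirstOrder

variable {β : Type*} [MeasurableSpace β] {f φ : β → ℝ} {G : ℝ → ℝ} {q : FiniteMeasure β}

/-- First-order condition obtained by adding mass at a point. -/
lemma first_order_add [MeasurableSingletonClass β]
    (hG : DifferentiableAt ℝ G (∫ z, φ z ∂(q : Measure β)))
    (hφ : Integrable φ (q : Measure β)) (hf : Integrable f (q : Measure β))
    (hmin : ∀ m : FiniteMeasure β, Integrable f (m : Measure β) →
      (∫ z, f z ∂(q : Measure β)) + G (∫ z, φ z ∂(q : Measure β)) ≤
        (∫ z, f z ∂(m : Measure β)) + G (∫ z, φ z ∂(m : Measure β))) (y : β) :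
    0 ≤ deriv G (∫ z, φ z ∂(q : Measure β)) * φ y + f y := by
  set U := ∫ z, φ z ∂(q : Measure β)
  set V := ∫ z, f z ∂(q : Measure β)
  have hd : HasDerivAt (fun t : ℝ => (V + t * f y) + G (U + t * φ y))
      (deriv G U * φ y + f y) 0 := by
    have h1 : HasDerivAt (fun t : ℝ => U + t * φ y) (φ y) 0 := by
      simpa using ((hasDerivAt_id (0 : ℝ)).mul_const (φ y)).const_add U
    have h2 : HasDerivAt (fun t : ℝ => V + t * f y) (f y) 0 := by
      simpa using ((hasDerivAt_id (0 : ℝ)).mul_const (f y)).const_add V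
    have h3 : HasDerivAt G (deriv G U) (U + 0 * φ y) := by simpa using hG.hasDerivAt
    rw [add_comm (deriv G U * φ y)]
    exact h2.add (h3.comp 0 h1)
  refine nonneg_of_hasDerivAt_of_le hd fun t ht _ => ?_
  let δ : FiniteMeasure β := ⟨Measure.dirac y, inferInstance⟩
  have hint : ∀ g : β → ℝ, Integrable g (((t.toNNReal • δ : FiniteMeasure β)) : Measure β) :=
    fun g => (integrable_dirac (by simp)).smul_measure_nnreal
  have hval : ∀ g : β → ℝ, Integrable g (q : Measure β) →
      ∫ z, g z ∂((q + t.toNNReal • δ : FiniteMeasure β) : Measure β) =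
        (∫ z, g z ∂(q : Measure β)) + t * g y := by
    intro g hg
    rw [FiniteMeasure.toMeasure_add, integral_add_measure hg (hint g),
      FiniteMeasure.toMeasure_smul, integral_smul_nnreal_measure]
    simp [δ, NNReal.smul_def, ht.le]
  have := hmin (q + t.toNNReal • δ) (hf.add_measure (hint f))
  rw [hval f hf, hval φ hφ] at this
  simpa using this

/-- First-order condition obtained by scaling the minimizer down. -/
lemma first_order_scale
    (hG : DifferentiableAt ℝ G (∫ z, φ z ∂(q : Measure β)))
    (hf : Integrable f (q : Measure β))
    (hmin : ∀ m : FiniteMeasure β, Integrable f (m : Measure β) →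
      (∫ z, f z ∂(q : Measure β)) + G (∫ z, φ z ∂(q : Measure β)) ≤
        (∫ z, f z ∂(m : Measure β)) + G (∫ z, φ z ∂(m : Measure β))) :
    deriv G (∫ z, φ z ∂(q : Measure β)) * (∫ z, φ z ∂(q : Measure β)) +
      (∫ z, f z ∂(q : Measure β)) ≤ 0 := by
  set U := ∫ z, φ z ∂(q : Measure β) with hU
  set V := ∫ z, f z ∂(q : Measure β) with hV
  have hd : HasDerivAt (fun t : ℝ => (1 - t) * V + G ((1 - t) * U))
      (-(deriv G U * U + V)) 0 := by
    have h0 : ∀ c : ℝ, HasDerivAt (fun t : ℝ => (1 - t) * c) (-c) 0 := fun c => by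
      simpa using ((hasDerivAt_id (0 : ℝ)).const_sub 1).mul_const c
    have h3 : HasDerivAt G (deriv G U) ((1 - 0) * U) := by simpa using hG.hasDerivAt
    convert! (h0 V).add (h3.comp 0 (h0 U)) using 1
    ring
  have := nonneg_of_hasDerivAt_of_le hd fun t _ ht1 => ?_
  · linarith
  have hval : ∀ g : β → ℝ,
      ∫ z, g z ∂(((1 - t).toNNReal • q : FiniteMeasure β) : Measure β) =
        (1 - t) * (∫ z, g z ∂(q : Measure β)) := by
    intro g
    rw [FiniteMeasure.toMeasure_smul, integral_smul_nnreal_measure]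
    simp [NNReal.smul_def, ht1.le]
  have := hmin ((1 - t).toNNReal • q) hf.smul_measure_nnreal
  rw [hval, hval, ← hU, ← hV] at this
  simpa using this

end FirstOrder

/-- The integral of a positive function vanishes only for the zero measure. -/
lemma integral_pos_of_ne_zero {β : Type*} [MeasurableSpace β] {φ : β → ℝ} (hφ : ∀ y, 0 < φ y)
    {m : FiniteMeasure β} (hint : Integrable φ (m : Measure β)) (hm : m ≠ 0) :
    0 < ∫ y, φ y ∂(m : Measure β) := by
  rw [integral_pos_iff_support_of_nonneg (fun y => (hφ y).le) hint]
  have hs : Function.support φ = univ := eq_univ_of_forall fun y => (hφ y).ne'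
  rw [hs, Measure.measure_univ_pos]
  exact fun h => hm (FiniteMeasure.toMeasure_injective (by simpa using h))

/-- The tangent line of `G` at `1` is an affine minorant. -/
lemma tangent_le {G : ℝ → ℝ} (hG : ConvexOn ℝ (Ici 0) G)
    (hGd : ∀ u : ℝ, 0 < u → DifferentiableAt ℝ G u)
    {u : ℝ} (hu : 0 ≤ u) : G 1 + deriv G 1 * (u - 1) ≤ G u := by
  have h1 : (1 : ℝ) ∈ Ici (0 : ℝ) := mem_Ici.2 zero_le_one
  rcases lt_trichotomy u 1 with h | rfl | h
  · have := hG.slope_le_deriv hu h1 h (hGd 1 one_pos)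
    rw [slope_def_field, div_le_iff₀ (by linarith)] at this
    linarith
  · simp
  · have := hG.deriv_le_slope h1 hu h (hGd 1 one_pos)
    rw [slope_def_field, le_div_iff₀ (by linarith)] at this
    linarith

/-- If `G` grows from `0` at least at linear rate `a`, so does the limit of the derivative. -/
lemma le_limit_deriv {G : ℝ → ℝ} (hG : ConvexOn ℝ (Ici 0) G)
    (hGd : ∀ u : ℝ, 0 < u → DifferentiableAt ℝ G u)
    {G0' : EReal}
    (hG0' : Tendsto (fun u : ℝ => ((deriv G u : ℝ) : EReal)) (𝓝[>] (0 : ℝ)) (𝓝 G0')) {a : ℝ}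
    (ha : ∀ u, 0 < u → G 0 + a * u ≤ G u) : (a : EReal) ≤ G0' := by
  refine ge_of_tendsto hG0' ?_
  filter_upwards [self_mem_nhdsWithin] with u (hu : 0 < u)
  have h := hG.slope_le_deriv (mem_Ici.2 le_rfl) (mem_Ici.2 hu.le) hu (hGd u hu)
  rw [slope_def_field, sub_zero, div_le_iff₀ hu] at h
  exact EReal.coe_le_coe_iff.2 (le_of_mul_le_mul_right (by linarith [ha u hu]) hu)

lemma measurable_comp_of_nonneg {G : ℝ → ℝ}
    (hGd : ∀ u : ℝ, 0 < u → DifferentiableAt ℝ G u) {α : Type*} [MeasurableSpace α]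
    {U : α → ℝ} (hU : Measurable U)
    (h0 : ∀ x, 0 ≤ U x) : Measurable fun x => G (U x) := by
  have hc : ContinuousOn G (Ioi 0) := fun u hu => (hGd u hu).continuousAt.continuousWithinAt
  have hm : Measurable ((Ioi (0 : ℝ)).piecewise G fun _ => G 0) :=
    measurable_of_restrict_of_restrict_compl measurableSet_Ioi
      (by rw [domRestrict_piecewise]; exact (continuousOn_iff_continuous_domRestrict.1 hc).measurable)
      (by rw [domRestrict_piecewise_compl]; exact measurable_const)
  convert! hm.comp hU using 2 with x
  rcases (h0 x).eq_or_lt with h | h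
  · simp [← h]
  · simp [h]

/-- The dual transform is Borel, being an infimum of continuous functions. -/
lemma measurable_KcL1 {α β : Type*} [TopologicalSpace α] [FirstCountableTopology α]
    [MeasurableSpace α] [OpensMeasurableSpace α] [TopologicalSpace β] [PolishSpace β]
    [MeasurableSpace β] [BorelSpace β]
    {F : α → β → ℝ} (hF : Continuous fun p : α × β => F p.1 p.2) (hFpos : ∀ x y, 0 < F x y)
    {C : ℝ} (hC : ∀ x y, ‖F x y‖ ≤ C) {G : ℝ → ℝ}
    (hGd : ∀ u : ℝ, 0 < u → DifferentiableAt ℝ G u) (f : β → ℝ) :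
    Measurable (KcL1 (cGF F G) f) := by
  have hcont : ∀ m : FiniteMeasure β, Continuous fun x => cGF F G x m := by
    intro m
    by_cases hm : m = 0
    · simpa [hm, cGF] using continuous_const
    have hU : Continuous fun x => ∫ y, F x y ∂(m : Measure β) :=
      continuous_of_dominated
        (fun x => (hF.comp (Continuous.prodMk_right x)).aestronglyMeasurable)
        (fun x => ae_of_all _ (hC x)) (integrable_const C)
        (ae_of_all _ fun y => hF.comp (Continuous.prodMk_left y))
    refine continuous_iff_continuousAt.2 fun x => ?_
    have hint : Integrable (F x) (m : Measure β) :=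
      (integrable_const C).mono' (hF.comp (Continuous.prodMk_right x)).aestronglyMeasurable
        (ae_of_all _ (hC x))
    have hp := integral_pos_of_ne_zero (hFpos x) hint hm
    exact ContinuousAt.comp (f := fun x => ∫ y, F x y ∂(m : Measure β)) (hGd _ hp).continuousAt
      hU.continuousAt
  refine UpperSemicontinuous.measurable ?_
  refine upperSemicontinuous_iInf fun m => Continuous.upperSemicontinuous ?_
  exact continuous_coe_real_ereal.comp (continuous_const.add (hcont m))

/-- If the zero measure is a minimizer, testing against point masses gives linear growth of `G`. -/
lemma growth_of_zero_minimizer {β : Type*} [MeasurableSpace β] [MeasurableSingletonClass β]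
    {f φ : β → ℝ} {G : ℝ → ℝ} {y : β} (hφ : 0 < φ y)
    (hmin : ∀ m : FiniteMeasure β, Integrable f (m : Measure β) →
      G 0 ≤ (∫ z, f z ∂(m : Measure β)) + G (∫ z, φ z ∂(m : Measure β)))
    {u : ℝ} (hu : 0 < u) : G 0 + -(f y) / φ y * u ≤ G u := by
  let δ : FiniteMeasure β := ⟨Measure.dirac y, inferInstance⟩
  have ht : 0 ≤ u / φ y := (div_pos hu hφ).le
  have hval : ∀ g : β → ℝ,
      ∫ z, g z ∂(((u / φ y).toNNReal • δ : FiniteMeasure β) : Measure β) = u / φ y * g y := by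
    intro g
    rw [FiniteMeasure.toMeasure_smul, integral_smul_nnreal_measure]
    simp [δ, NNReal.smul_def, ht]
  have h := hmin ((u / φ y).toNNReal • δ) (integrable_dirac (by simp)).smul_measure_nnreal
  rw [hval, hval, div_mul_cancel₀ _ hφ.ne'] at h
  have : -(f y) / φ y * u = -(u / φ y * f y) := by ring
  linarith

lemma zero_le_mul_add_of_div_le {a : EReal} {b c : ℝ} (hb : 0 < b)
    (h : ((-c / b : ℝ) : EReal) ≤ a) : 0 ≤ a * (b : EReal) + (c : EReal) := by
  induction a with
  | bot => exact absurd (le_bot_iff.1 h) (EReal.coe_ne_bot _)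
  | coe a =>
    rw [EReal.coe_le_coe_iff, div_le_iff₀ hb] at h
    have : 0 ≤ a * b + c := by linarith
    exact_mod_cast this
  | top => simp [EReal.top_mul_coe_of_pos hb]

/-- Proposition `prop:dualprimal`: first-order relation between a primal
kernel minimizer `q̄` and a dual optimizer `f̄` for costs `c(x,m) = G(∫ F(x,y) dm)`.
Here `G' : [0,∞) → ℝ ∪ {−∞}` is encoded by `deriv G` on `(0,∞)` and by the limit
`G0' = lim_{u→0⁺} G'(u) ∈ ℝ ∪ {−∞}` at `0`. -/
theorem primal_dual_relation_GF
    [CompactSpace X] [CompactSpace Y]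
    (F : X → Y → ℝ) (hFcont : Continuous fun p : X × Y => F p.1 p.2)
    (hFpos : ∀ x y, 0 < F x y)
    (G : ℝ → ℝ) (hGconv : ConvexOn ℝ (Ici 0) G)
    (hGdiff : ∀ u : ℝ, 0 < u → DifferentiableAt ℝ G u)
    (G0' : EReal)
    (hG0' : Tendsto (fun u : ℝ => ((deriv G u : ℝ) : EReal)) (𝓝[>] (0 : ℝ)) (𝓝 G0'))
    (μ : Measure X) (ν : Measure Y)
    [IsProbabilityMeasure μ] [IsProbabilityMeasure ν]
    (hfin : transportCost (cGF F G) μ ν ≠ ⊤)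
    (qbar : X → FiniteMeasure Y) (hq : IsKernel qbar) (hqt : Transports μ qbar ν)
    (hqmin : eintegralR μ (fun x => cGF F G x (qbar x)) = transportCost (cGF F G) μ ν)
    (fbar : Y → ℝ) (hfmeas : Measurable fbar) (hfint : Integrable fbar ν)
    (hfdual : transportCost (cGF F G) μ ν =
      eintegral μ (KcL1 (cGF F G) fbar) - ((∫ y, fbar y ∂ν : ℝ) : EReal)) :
    (∀ᵐ x ∂μ,
      (∀ y : Y,
        (0 : EReal) ≤
          (if (∫ z, F x z ∂(qbar x : Measure Y)) = 0 then G0'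
            else ((deriv G (∫ z, F x z ∂(qbar x : Measure Y)) : ℝ) : EReal)) *
              ((F x y : ℝ) : EReal) + ((fbar y : ℝ) : EReal)) ∧
      (∀ᵐ y ∂(qbar x : Measure Y),
        (if (∫ z, F x z ∂(qbar x : Measure Y)) = 0 then G0'
          else ((deriv G (∫ z, F x z ∂(qbar x : Measure Y)) : ℝ) : EReal)) *
            ((F x y : ℝ) : EReal) + ((fbar y : ℝ) : EReal) = 0)) ∧
    (G0' = ⊥ → ∀ᵐ x ∂μ, 0 < (qbar x).mass) := by
  obtain ⟨C, hC⟩ : ∃ C : ℝ, ∀ x y, ‖F x y‖ ≤ C := by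
    obtain ⟨C, hC⟩ := isCompact_univ.exists_bound_of_continuousOn hFcont.continuousOn
    exact ⟨C, fun x y => hC (x, y) (mem_univ _)⟩
  have hFi : ∀ x (m : FiniteMeasure Y), Integrable (F x) (m : Measure Y) := fun x m =>
    (integrable_const C).mono' (hFcont.comp (Continuous.prodMk_right x)).aestronglyMeasurable
      (ae_of_all _ (hC x))
  let κ : Kernel X Y := ⟨fun x => (qbar x : Measure Y), hq⟩
  have hκ : ∀ x, κ x = (qbar x : Measure Y) := fun _ => rfl
  have : ∀ x, IsFiniteMeasure (κ x) := fun x => (qbar x).isFiniteMeasure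
  have : IsSFiniteKernel κ := isSFiniteKernel_of_isFiniteMeasure κ
  have hcomp : κ ∘ₘ μ = ν := hqt
  set U : X → ℝ := fun x => ∫ z, F x z ∂(qbar x : Measure Y) with hU
  have hUm : Measurable U :=
    (StronglyMeasurable.integral_kernel_prod_right (κ := κ)
      (f := F) hFcont.measurable.stronglyMeasurable).measurable
  have hU0 : ∀ x, 0 ≤ U x := fun x => integral_nonneg fun y => (hFpos x y).le
  have hUi : Integrable U μ := by
    have h1 : Integrable (fun x => ∫ y, ‖C‖ ∂κ x) μ :=
      Measure.integrable_integral_norm_of_integrable_comp (f := fun _ : Y => C)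
        (hcomp ▸ integrable_const C)
    refine h1.mono' hUm.aestronglyMeasurable (ae_of_all _ fun x => ?_)
    refine (norm_integral_le_integral_norm _).trans
      (integral_mono (hFi x (qbar x)).norm (integrable_const _) fun y => ?_)
    exact (hC x y).trans (le_abs_self C)
  have hGU : Measurable fun x => G (U x) := measurable_comp_of_nonneg hGdiff hUm hU0
  have hbot : eintegralR μ (fun x => G (U x)) ≠ ⊥ :=
    eintegralR_ne_bot (h := fun x => G 1 + deriv G 1 * (U x - 1))
      ((integrable_const _).add ((hUi.sub (integrable_const _)).const_mul _))
      fun x => tangent_le hGconv hGdiff (hU0 x)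
  change eintegralR μ (fun x => G (U x)) = _ at hqmin
  have htop : eintegralR μ (fun x => G (U x)) ≠ ⊤ := hqmin ▸ hfin
  obtain ⟨-, hGi, hGe⟩ := integrable_toReal_of_eintegral hGU.coe_real_ereal htop hbot
  simp only [EReal.toReal_coe] at hGi hGe
  change eintegralR μ (fun x => G (U x)) = _ at hGe
  rw [← hqmin, hGe] at hfdual
  have hfi : ∀ᵐ x ∂μ, Integrable fbar (qbar x : Measure Y) :=
    Measure.ae_integrable_of_integrable_comp (κ := κ) (hcomp.symm ▸ hfint)
  have hfκ : Integrable fbar ((κ ∘ₖ Kernel.const Unit μ) ()) := by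
    rwa [← Measure.comp_eq_comp_const_apply, hcomp]
  have hfI : Integrable (fun x => ∫ y, fbar y ∂(qbar x : Measure Y)) μ := by
    simpa [hκ] using hfκ.integral_comp
  have hfe : ∫ x, ∫ y, fbar y ∂(qbar x : Measure Y) ∂μ = ∫ y, fbar y ∂ν := by
    have h := Kernel.integral_comp hfκ
    rw [← Measure.comp_eq_comp_const_apply, hcomp] at h
    simpa [hκ] using h.symm
  have hKm := measurable_KcL1 hFcont hFpos hC hGdiff fbar
  have hKtop : eintegral μ (KcL1 (cGF F G) fbar) ≠ ⊤ := by
    intro h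
    rw [h, EReal.top_sub_coe] at hfdual
    exact EReal.coe_ne_top _ hfdual
  have hKbot : eintegral μ (KcL1 (cGF F G) fbar) ≠ ⊥ := by
    intro h
    rw [h, EReal.bot_sub] at hfdual
    exact EReal.coe_ne_bot _ hfdual
  obtain ⟨hKfin, hKi, hKe⟩ := integrable_toReal_of_eintegral hKm hKtop hKbot
  rw [hKe, ← EReal.coe_sub, EReal.coe_eq_coe_iff] at hfdual
  have hKle : ∀ x (m : FiniteMeasure Y), Integrable fbar (m : Measure Y) →
      KcL1 (cGF F G) fbar x ≤ (((∫ y, fbar y ∂(m : Measure Y)) + cGF F G x m : ℝ) : EReal) :=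
    fun x m hm => iInf_le (fun m : {m : FiniteMeasure Y // Integrable fbar (m : Measure Y)} =>
      (((∫ y, fbar y ∂((m : FiniteMeasure Y) : Measure Y)) + cGF F G x m : ℝ) : EReal)) ⟨m, hm⟩
  have hae : (fun x => (KcL1 (cGF F G) fbar x).toReal) =ᵐ[μ]
      fun x => (∫ y, fbar y ∂(qbar x : Measure Y)) + G (U x) := by
    refine (integral_eq_iff_of_ae_le hKi (hfI.add hGi) ?_).1 ?_
    · filter_upwards [hKfin, hfi] with x hx hxf
      have h := hKle x (qbar x) hxf
      rw [← EReal.coe_toReal hx.1 hx.2, EReal.coe_le_coe_iff] at h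
      exact h
    · rw [integral_add' hfI hGi, hfe]
      linarith
  have hmin : ∀ᵐ x ∂μ, Integrable fbar (qbar x : Measure Y) ∧
      ∀ m : FiniteMeasure Y, Integrable fbar (m : Measure Y) →
      (∫ z, fbar z ∂(qbar x : Measure Y)) + G (∫ z, F x z ∂(qbar x : Measure Y)) ≤
        (∫ z, fbar z ∂(m : Measure Y)) + G (∫ z, F x z ∂(m : Measure Y)) := by
    filter_upwards [hae, hKfin, hfi] with x hx hx' hxf
    refine ⟨hxf, fun m hm => ?_⟩
    have h := hKle x m hm
    rw [← EReal.coe_toReal hx'.1 hx'.2, EReal.coe_le_coe_iff, hx] at h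
    exact h
  have key : ∀ᵐ x ∂μ,
      (∀ y : Y, (0 : EReal) ≤
        (if U x = 0 then G0' else ((deriv G (U x) : ℝ) : EReal)) *
          ((F x y : ℝ) : EReal) + ((fbar y : ℝ) : EReal)) ∧
      (∀ᵐ y ∂(qbar x : Measure Y),
        (if U x = 0 then G0' else ((deriv G (U x) : ℝ) : EReal)) *
          ((F x y : ℝ) : EReal) + ((fbar y : ℝ) : EReal) = 0) := by
    filter_upwards [hmin] with x hx
    obtain ⟨hxf, hx⟩ := hx
    by_cases h0 : qbar x = 0
    · have hUx : U x = 0 := by simp [hU, h0]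
      simp only [hUx, if_true, h0, FiniteMeasure.toMeasure_zero, ae_zero, eventually_bot, and_true]
      intro y
      exact zero_le_mul_add_of_div_le (hFpos x y) <| le_limit_deriv hGconv hGdiff hG0' fun u hu =>
        growth_of_zero_minimizer (hFpos x y) (by simpa [h0] using hx) hu
    · have hUx : 0 < U x := integral_pos_of_ne_zero (hFpos x) (hFi x _) h0
      simp only [hUx.ne', if_false]
      have hadd := first_order_add (hGdiff _ hUx) (hFi x _) hxf hx
      have hscale := first_order_scale (hGdiff _ hUx) hxf hx
      refine ⟨fun y => by exact_mod_cast hadd y, ?_⟩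
      have hint := ((hFi x (qbar x)).const_mul (deriv G (U x))).add hxf
      have hz : ∫ y, (deriv G (U x) * F x y + fbar y) ∂(qbar x : Measure Y) = 0 := by
        refine le_antisymm ?_ (integral_nonneg hadd)
        rw [integral_add ((hFi x (qbar x)).const_mul _) hxf, integral_const_mul]
        exact hscale
      filter_upwards [(integral_eq_zero_iff_of_nonneg hadd hint).1 hz] with y hy
      exact_mod_cast hy
  refine ⟨key, fun hG0 => ?_⟩
  filter_upwards [key] with x hx
  rw [pos_iff_ne_zero, FiniteMeasure.mass_nonzero_iff]
  intro h0
  have hUx : U x = 0 := by simp [hU, h0]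
  have h := hx.1 (Classical.arbitrary Y)
  rw [if_pos hUx, hG0, EReal.bot_mul_coe_of_pos (hFpos _ _), EReal.bot_add] at h
  exact absurd h (by simp)

end UWOT
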